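/- Let B⁴₀₁ be the 4-dimensional ℂ-algebra with basis e_1,e_2,e_3,e_4 and only nonzero basis products e_1e_1 = e_2 and e_2e_1 = e_3. Each of the five bilinear forms Δ₁₂, Δ₁₄, Δ₃₁, Δ₄₁, Δ₄₄ is a cocycle on B⁴₀₁, and their cosets modulo B²(B⁴₀₁,ℂ) form a basis of H²(B⁴₀₁,ℂ); in particular dim H²(B⁴₀₁,ℂ) = 5. -/

import Mathlib

/-- The elementary bilinear multiplication on `ℂ^n` sending `(x, y)` to
`(x_i * y_j) • e_k`; the concrete algebra below is a sum of such terms. -/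
noncomputable def T {n : ℕ} (i j k : Fin n) :
    (Fin n → ℂ) →ₗ[ℂ] (Fin n → ℂ) →ₗ[ℂ] (Fin n → ℂ) :=
  LinearMap.mk₂ ℂ (fun x y => (x i * y j) • (Pi.single k 1 : Fin n → ℂ))
    (fun x x' y => by simp [add_mul, add_smul])
    (fun c x y => by simp [smul_eq_mul, smul_smul, mul_assoc])
    (fun x y y' => by simp [mul_add, add_smul])
    (fun c x y => by simp [smul_eq_mul, smul_smul, mul_left_comm])

/-- The bilinear form `Δ_{ij}` on `ℂ^n` (0-indexed): `Δ_{ij}(x,y) = x_i y_j`,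
so that `Δ_{ij}(e_l, e_m) = δ_{il} δ_{jm}`. -/
noncomputable def D {n : ℕ} (i j : Fin n) :
    (Fin n → ℂ) →ₗ[ℂ] (Fin n → ℂ) →ₗ[ℂ] ℂ :=
  LinearMap.mk₂ ℂ (fun x y => x i * y j)
    (fun x x' y => by simp [add_mul])
    (fun c x y => by simp [mul_assoc])
    (fun x y y' => by simp [mul_add])
    (fun c x y => by simp [smul_eq_mul, mul_left_comm])

/-- The cocycle condition: `θ(xy,z) = θ(xz,y)` and `θ(x,yz) = θ(y,xz)`. -/
def IsCocycle {A V : Type*} [AddCommGroup A] [Module ℂ A] [AddCommGroup V] [Module ℂ V]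
    (m : A →ₗ[ℂ] A →ₗ[ℂ] A) (θ : A →ₗ[ℂ] A →ₗ[ℂ] V) : Prop :=
  (∀ x y z : A, θ (m x y) z = θ (m x z) y) ∧ (∀ x y z : A, θ x (m y z) = θ y (m x z))

/-- `Z²(A,ℂ)`: the space of scalar-valued cocycles. -/
noncomputable def Zsub {A : Type*} [AddCommGroup A] [Module ℂ A]
    (m : A →ₗ[ℂ] A →ₗ[ℂ] A) : Submodule ℂ (A →ₗ[ℂ] A →ₗ[ℂ] ℂ) where
  carrier := {θ | IsCocycle m θ}
  add_mem' := by
    rintro θ η ⟨h1, h2⟩ ⟨g1, g2⟩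
    refine ⟨fun x y z => ?_, fun x y z => ?_⟩
    · simp only [LinearMap.add_apply]
      rw [h1 x y z, g1 x y z]
    · simp only [LinearMap.add_apply]
      rw [h2 x y z, g2 x y z]
  zero_mem' := ⟨fun x y z => by simp, fun x y z => by simp⟩
  smul_mem' := by
    rintro c θ ⟨h1, h2⟩
    refine ⟨fun x y z => ?_, fun x y z => ?_⟩
    · simp only [LinearMap.smul_apply]
      rw [h1 x y z]
    · simp only [LinearMap.smul_apply]
      rw [h2 x y z]

/-- The coboundary map `f ↦ δf = ((x,y) ↦ f(xy))`. -/
noncomputable def cobound {A : Type*} [AddCommGroup A] [Module ℂ A]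
    (m : A →ₗ[ℂ] A →ₗ[ℂ] A) : (A →ₗ[ℂ] ℂ) →ₗ[ℂ] (A →ₗ[ℂ] A →ₗ[ℂ] ℂ) where
  toFun f := m.compr₂ f
  map_add' f g := by ext x y; simp [LinearMap.compr₂_apply]
  map_smul' c f := by ext x y; simp [LinearMap.compr₂_apply]

/-- `B²(A,ℂ)`: the space of scalar-valued coboundaries. -/
noncomputable def Bsub {A : Type*} [AddCommGroup A] [Module ℂ A]
    (m : A →ₗ[ℂ] A →ₗ[ℂ] A) : Submodule ℂ (A →ₗ[ℂ] A →ₗ[ℂ] ℂ) :=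
  LinearMap.range (cobound m)

/-- The coset of a bilinear form modulo `B²(A,ℂ)`. -/
noncomputable def cls {A : Type*} [AddCommGroup A] [Module ℂ A]
    (m : A →ₗ[ℂ] A →ₗ[ℂ] A) (θ : A →ₗ[ℂ] A →ₗ[ℂ] ℂ) :
    (A →ₗ[ℂ] A →ₗ[ℂ] ℂ) ⧸ Bsub m :=
  (Bsub m).mkQ θ

/-- `H²(A,ℂ) = Z²(A,ℂ)/B²(A,ℂ)`, realized as the image of the cocycles in the
quotient of the space of all bilinear forms by the coboundaries. -/
noncomputable def H2 {A : Type*} [AddCommGroup A] [Module ℂ A]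
    (m : A →ₗ[ℂ] A →ₗ[ℂ] A) : Submodule ℂ ((A →ₗ[ℂ] A →ₗ[ℂ] ℂ) ⧸ Bsub m) :=
  (Zsub m).map (Bsub m).mkQ

/-- The algebra `B⁴₀₁` on `ℂ^4`: `e_1 e_1 = e_2`, `e_2 e_1 = e_3`. -/
noncomputable def mul : (Fin 4 → ℂ) →ₗ[ℂ] (Fin 4 → ℂ) →ₗ[ℂ] (Fin 4 → ℂ) :=
  T 0 0 1 + T 1 0 2

/-- The forms `Δ₁₂, Δ₁₄, Δ₃₁, Δ₄₁, Δ₄₄` (0-indexed). -/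
noncomputable def forms : Fin 5 → ((Fin 4 → ℂ) →ₗ[ℂ] (Fin 4 → ℂ) →ₗ[ℂ] ℂ) :=
  ![D 0 1, D 0 3, D 2 0, D 3 0, D 3 3]

theorem mul_apply_eq (x y : Fin 4 → ℂ) : mul x y = ![0, x 0 * y 0, x 1 * y 0, 0] := by
  ext k
  fin_cases k <;> simp [mul, T]

theorem sum_smul_forms_apply (g : Fin 5 → ℂ) (x y : Fin 4 → ℂ) :
    (∑ i, g i • forms i) x y =
      g 0 * (x 0 * y 1) + g 1 * (x 0 * y 3) + g 2 * (x 2 * y 0) + g 3 * (x 3 * y 0) +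
        g 4 * (x 3 * y 3) := by
  simp [Fin.sum_univ_five, forms, D]

theorem isCocycle_forms (i : Fin 5) : IsCocycle mul (forms i) := by
  constructor <;> intro x y z <;> fin_cases i <;> simp [forms, D, mul_apply_eq] <;> ring

theorem linearIndependent_cls_forms : LinearIndependent ℂ (fun i => cls mul (forms i)) := by
  rw [Fintype.linearIndependent_iff]
  intro g hg
  have hmem : ∑ i, g i • forms i ∈ Bsub mul := by
    rw [← Submodule.ker_mkQ (Bsub mul), LinearMap.mem_ker, map_sum]
    simpa only [map_smul, cls] using hg
  obtain ⟨f, hf⟩ := hmem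
  have key (x y : Fin 4 → ℂ) := (DFunLike.congr_fun (DFunLike.congr_fun hf x) y).trans
    (sum_smul_forms_apply g x y)
  have hzero : (![0, 0, 0, 0] : Fin 4 → ℂ) = 0 := by ext k; fin_cases k <;> rfl
  have h₀ := key (Pi.single 0 1) (Pi.single 1 1)
  have h₁ := key (Pi.single 0 1) (Pi.single 3 1)
  have h₂ := key (Pi.single 2 1) (Pi.single 0 1)
  have h₃ := key (Pi.single 3 1) (Pi.single 0 1)
  have h₄ := key (Pi.single 3 1) (Pi.single 3 1)
  simp [cobound, mul_apply_eq, hzero] at h₀ h₁ h₂ h₃ h₄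
  intro i
  fin_cases i <;> simp [← h₀, ← h₁, ← h₂, ← h₃, ← h₄]

/-- A cocycle is the sum of the coboundary of `θ₁₁ e₂* + θ₂₁ e₃*` and a combination of `forms`. -/
theorem IsCocycle.eq_cobound_add_sum {θ : (Fin 4 → ℂ) →ₗ[ℂ] (Fin 4 → ℂ) →ₗ[ℂ] ℂ}
    (hθ : IsCocycle mul θ) :
    ∃ (f : (Fin 4 → ℂ) →ₗ[ℂ] ℂ) (g : Fin 5 → ℂ), θ = cobound mul f + ∑ i, g i • forms i := by
  let e (i : Fin 4) : Fin 4 → ℂ := Pi.single i 1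
  have h₀₀ : mul (e 0) (e 0) = e 1 := by
    rw [mul_apply_eq]; ext k; fin_cases k <;> simp [e]
  have h₁₀ : mul (e 1) (e 0) = e 2 := by
    rw [mul_apply_eq]; ext k; fin_cases k <;> simp [e]
  have hright (x : Fin 4 → ℂ) {j : Fin 4} (hj : j ≠ 0) : mul x (e j) = 0 := by
    rw [mul_apply_eq]; ext k; fin_cases k <;> simp [e, hj.symm]
  have hleft (y : Fin 4 → ℂ) : mul (e 2) y = 0 ∧ mul (e 3) y = 0 := by
    constructor <;> rw [mul_apply_eq] <;> ext k <;> fin_cases k <;> simp [e]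
  have hrow₁ {j : Fin 4} (hj : j ≠ 0) : θ (e 1) (e j) = 0 := by
    rw [← h₀₀, hθ.1, hright _ hj, map_zero, LinearMap.zero_apply]
  have hrow₂ {j : Fin 4} (hj : j ≠ 0) : θ (e 2) (e j) = 0 := by
    rw [← h₁₀, hθ.1, hright _ hj, map_zero, LinearMap.zero_apply]
  have h₀₂ : θ (e 0) (e 2) = 0 := by
    rw [← h₁₀, hθ.2, h₀₀, hrow₁ (by decide)]
  have h₃₁ : θ (e 3) (e 1) = 0 := by
    rw [← h₀₀, hθ.2, (hleft _).2, map_zero]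
  have h₃₂ : θ (e 3) (e 2) = 0 := by
    rw [← h₁₀, hθ.2, (hleft _).2, map_zero]
  refine ⟨θ (e 0) (e 0) • LinearMap.proj 1 + θ (e 1) (e 0) • LinearMap.proj 2,
    ![θ (e 0) (e 1), θ (e 0) (e 3), θ (e 2) (e 0), θ (e 3) (e 0), θ (e 3) (e 3)], ?_⟩
  refine (Pi.basisFun ℂ (Fin 4)).ext fun i => (Pi.basisFun ℂ (Fin 4)).ext fun j => ?_
  rw [LinearMap.add_apply, LinearMap.add_apply, sum_smul_forms_apply, Pi.basisFun_apply,
    Pi.basisFun_apply]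
  change θ (e i) (e j) = _
  fin_cases i <;> fin_cases j <;>
    simp [cobound, mul_apply_eq, hrow₁, hrow₂, h₀₂, h₃₁, h₃₂]

theorem span_cls_forms : Submodule.span ℂ (Set.range fun i => cls mul (forms i)) = H2 mul := by
  apply le_antisymm
  · rw [Submodule.span_le]
    rintro _ ⟨i, rfl⟩
    exact Submodule.mem_map_of_mem (isCocycle_forms i)
  · rintro _ ⟨θ, hθ, rfl⟩
    obtain ⟨f, g, rfl⟩ := IsCocycle.eq_cobound_add_sum hθ
    have hf : (Bsub mul).mkQ (cobound mul f) = 0 := by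
      rw [← LinearMap.mem_ker, Submodule.ker_mkQ]
      exact LinearMap.mem_range_self _ f
    rw [map_add, hf, zero_add, map_sum]
    refine Submodule.sum_mem _ fun i _ => ?_
    rw [map_smul]
    exact Submodule.smul_mem _ _ (Submodule.subset_span ⟨i, rfl⟩)

/-- The listed forms are cocycles, their cosets modulo `B²` form a basis of `H²`,
and in particular `dim H² = 5`. -/
theorem secondCohomology_B4_01 :
    (∀ i, IsCocycle mul (forms i)) ∧
    LinearIndependent ℂ (fun i => cls mul (forms i)) ∧
    Submodule.span ℂ (Set.range fun i => cls mul (forms i)) = H2 mul ∧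
    Module.finrank ℂ (H2 mul) = 5 := by
  refine ⟨isCocycle_forms, linearIndependent_cls_forms, span_cls_forms, ?_⟩
  rw [← span_cls_forms, finrank_span_eq_card linearIndependent_cls_forms, Fintype.card_fin]
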